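/- Let 1 ≤ p < q < ∞ be real numbers. The formal inclusion map R : ℓ_p → ℓ_q, which sends a p-summable sequence to itself regarded as a q-summable sequence (a bounded linear operator, since ‖x‖_q ≤ ‖x‖_p), is strictly singular but not compact. -/

import Mathlib

/-- A bounded linear operator `T : E → F` between normed spaces is *strictly singular* if
for every infinite-dimensional subspace `M` of `E` and every `c > 0` there exists `x ∈ M`
with `‖T x‖ < c * ‖x‖`. -/
def StrictlySingular {E F : Type*} [NormedAddCommGroup E] [NormedSpace ℝ E]
    [NormedAddCommGroup F] [NormedSpace ℝ F] (T : E →L[ℝ] F) : Prop :=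
  ∀ M : Submodule ℝ E, ¬ FiniteDimensional ℝ M → ∀ c : ℝ, 0 < c → ∃ x ∈ M, ‖T x‖ < c * ‖x‖

open Filter
open scoped ENNReal

namespace lp

/-- The interpolation inequality `‖x‖_q ^ q ≤ ‖x‖_∞ ^ (q - p) * ‖x‖_p ^ p`. -/
theorem norm_linearMapOfLE_rpow_le {p q : ℝ≥0∞} (hp : 0 < p.toReal) (hpq : p ≤ q) (hq : q ≠ ∞)
    (x : lp (fun _ : ℕ => ℝ) p) {K : ℝ} (hK : ∀ i, |x i| ≤ K) :
    ‖linearMapOfLE ℝ (fun _ : ℕ => ℝ) hpq x‖ ^ q.toReal ≤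
      K ^ (q.toReal - p.toReal) * ‖x‖ ^ p.toReal := by
  have hpq' : p.toReal ≤ q.toReal := ENNReal.toReal_mono hq hpq
  refine hasSum_le (fun i => ?_) (lp.hasSum_norm (hp.trans_le hpq') _)
    ((lp.hasSum_norm hp x).mul_left _)
  rw [coe_linearMapOfLE_apply, Real.norm_eq_abs]
  calc |x i| ^ q.toReal = |x i| ^ (q.toReal - p.toReal) * |x i| ^ p.toReal := by
        rw [← Real.rpow_add_of_nonneg (abs_nonneg _) (sub_nonneg.2 hpq') hp.le, sub_add_cancel]
    _ ≤ K ^ (q.toReal - p.toReal) * |x i| ^ p.toReal := by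
        gcongr
        exact hK i

theorem norm_linearMapOfLE_le {p q : ℝ≥0∞} (hp : 0 < p.toReal) (hpq : p ≤ q) (hq : q ≠ ∞)
    (x : lp (fun _ : ℕ => ℝ) p) : ‖linearMapOfLE ℝ (fun _ : ℕ => ℝ) hpq x‖ ≤ ‖x‖ := by
  have hpq' : p.toReal ≤ q.toReal := ENNReal.toReal_mono hq hpq
  have h := norm_linearMapOfLE_rpow_le hp hpq hq x
    (fun i => norm_apply_le_norm (ENNReal.toReal_pos_iff.1 hp).1.ne' x i)
  rw [← Real.rpow_add_of_nonneg (norm_nonneg' x) (sub_nonneg.2 hpq') hp.le, sub_add_cancel] at h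
  exact (Real.rpow_le_rpow_iff (norm_nonneg' _) (norm_nonneg' x) (hp.trans_le hpq')).1 h

theorem finite_setOf_le_abs {p : ℝ≥0∞} (hp : 0 < p.toReal) (x : lp (fun _ : ℕ => ℝ) p)
    {ε : ℝ} (hε : 0 < ε) : {i | ε ≤ |x i|}.Finite := by
  have h := (lp.hasSum_norm hp x).summable.tendsto_cofinite_zero.eventually
    (gt_mem_nhds (Real.rpow_pos_of_pos hε p.toReal))
  refine (eventually_cofinite.1 h).subset fun i hi => ?_
  simpa using Real.rpow_le_rpow hε.le hi hp.le

/-- An infinite-dimensional subspace of `ℓ_p` contains a vector of supremum norm one whose first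
`N` coordinates vanish. -/
theorem exists_mem_eq_zero_of_lt {p : ℝ≥0∞} [Fact (1 ≤ p)] (hp : 0 < p.toReal)
    {M : Submodule ℝ (lp (fun _ : ℕ => ℝ) p)} (hM : ¬ FiniteDimensional ℝ M) (N : ℕ) :
    ∃ y ∈ M, (∀ i < N, y i = 0) ∧ (∀ i, |y i| ≤ 1) ∧ ∃ j, |y j| = 1 := by
  let f : M →ₗ[ℝ] (Fin N → ℝ) :=
    LinearMap.pi fun i => (evalₗ (𝕜 := ℝ) (fun _ : ℕ => ℝ) p (i : ℕ)) ∘ₗ M.subtype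
  obtain ⟨⟨z, hzM⟩, hz, hz0⟩ : ∃ z, f z = 0 ∧ z ≠ 0 := by
    by_contra! h
    exact hM (FiniteDimensional.of_injective f ((injective_iff_map_eq_zero f).2 h))
  obtain ⟨k, hk⟩ : ∃ k, z k ≠ 0 := by
    by_contra! h
    exact hz0 (Subtype.ext (lp.ext (funext h)))
  obtain ⟨j, hj, hmax⟩ := Set.exists_max_image _ (fun i => |z i|)
    (finite_setOf_le_abs hp z (abs_pos.2 hk)) ⟨k, le_refl |z k|⟩
  have hj0 : 0 < |z j| := (abs_pos.2 hk).trans_le hj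
  have hle (i : ℕ) : |z i| ≤ |z j| := by
    by_cases h : |z k| ≤ |z i|
    · exact hmax i h
    · exact (not_le.1 h).le.trans hj
  refine ⟨(z j)⁻¹ • z, M.smul_mem _ hzM, fun i hi => ?_, fun i => ?_, j, ?_⟩
  · have : z i = 0 := congrFun hz ⟨i, hi⟩
    simp [this]
  · rw [coeFn_smul, Pi.smul_apply, smul_eq_mul, abs_mul, abs_inv, inv_mul_le_iff₀ hj0, mul_one]
    exact hle i
  · rw [coeFn_smul, Pi.smul_apply, smul_eq_mul, abs_mul, abs_inv, inv_mul_cancel₀ hj0.ne']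

/-- Gliding hump: an infinite-dimensional subspace of `ℓ_p` contains vectors bounded by `2` with
arbitrarily many coordinates of absolute value at least `1 / 2`. -/
theorem exists_mem_card_eq {p : ℝ≥0∞} [Fact (1 ≤ p)] (hp : 0 < p.toReal)
    {M : Submodule ℝ (lp (fun _ : ℕ => ℝ) p)} (hM : ¬ FiniteDimensional ℝ M) (n : ℕ) :
    ∃ x ∈ M, (∀ i, |x i| ≤ 2) ∧ ∃ s : Finset ℕ, s.card = n ∧ ∀ i ∈ s, 1 / 2 ≤ |x i| := by
  induction n with
  | zero => exact ⟨0, M.zero_mem, by simp, ∅, by simp⟩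
  | succ n ih =>
    obtain ⟨x, hxM, hx2, s, hs, hxs⟩ := ih
    obtain ⟨N, hN⟩ := (finite_setOf_le_abs hp x one_half_pos).bddAbove
    have hsmall (i : ℕ) (hi : N + 1 ≤ i) : |x i| < 1 / 2 := by
      by_contra! h
      have := hN h
      omega
    obtain ⟨y, hyM, hy0, hy1, j, hj⟩ := exists_mem_eq_zero_of_lt hp hM (N + 1)
    have hjN : N + 1 ≤ j := by
      by_contra! h
      simp [hy0 j h] at hj
    refine ⟨x + y, M.add_mem hxM hyM, fun i => ?_, insert j s, ?_, fun i hi => ?_⟩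
    · rw [coeFn_add, Pi.add_apply]
      rcases lt_or_ge i (N + 1) with h | h
      · simpa [hy0 i h] using hx2 i
      · linarith [abs_add_le (x i) (y i), hsmall i h, hy1 i]
    · rw [Finset.card_insert_of_notMem fun h => (hsmall j hjN).not_ge (hxs j h), hs]
    · rw [coeFn_add, Pi.add_apply]
      rcases Finset.mem_insert.1 hi with rfl | h
      · have := abs_sub_abs_le_abs_sub (y i) (-x i)
        rw [abs_neg, sub_neg_eq_add, add_comm (y i)] at this
        linarith [hsmall i hjN]
      · have : i < N + 1 := Nat.lt_succ_of_le (hN (hxs i h))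
        simpa [hy0 i this] using hxs i h

theorem exists_mem_lt_norm {p : ℝ≥0∞} [Fact (1 ≤ p)] (hp : 0 < p.toReal)
    {M : Submodule ℝ (lp (fun _ : ℕ => ℝ) p)} (hM : ¬ FiniteDimensional ℝ M) (B : ℝ) :
    ∃ x ∈ M, (∀ i, |x i| ≤ 2) ∧ B < ‖x‖ := by
  have hpos : (0 : ℝ) < (1 / 2) ^ p.toReal := by positivity
  obtain ⟨n, hn⟩ := exists_nat_gt (|B| ^ p.toReal / (1 / 2) ^ p.toReal)
  obtain ⟨x, hxM, hx2, s, hs, hxs⟩ := exists_mem_card_eq hp hM n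
  refine ⟨x, hxM, hx2, (le_abs_self B).trans_lt ?_⟩
  rw [← Real.rpow_lt_rpow_iff (abs_nonneg B) (norm_nonneg x) hp]
  calc |B| ^ p.toReal < n * (1 / 2) ^ p.toReal := (div_lt_iff₀ hpos).1 hn
    _ = ∑ _i ∈ s, (1 / 2 : ℝ) ^ p.toReal := by rw [Finset.sum_const, hs, nsmul_eq_mul]
    _ ≤ ∑ i ∈ s, ‖x i‖ ^ p.toReal :=
        Finset.sum_le_sum fun i hi => Real.rpow_le_rpow (by norm_num) (hxs i hi) hp.le
    _ ≤ ‖x‖ ^ p.toReal := sum_rpow_le_norm_rpow hp x s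

/-- The formal inclusion `ℓ_p → ℓ_q` as a bounded linear operator. -/
noncomputable def inclusionCLM {p q : ℝ≥0∞} [Fact (1 ≤ p)] [Fact (1 ≤ q)] (hp : 0 < p.toReal)
    (hpq : p ≤ q) (hq : q ≠ ∞) : lp (fun _ : ℕ => ℝ) p →L[ℝ] lp (fun _ : ℕ => ℝ) q :=
  (linearMapOfLE ℝ (fun _ : ℕ => ℝ) hpq).mkContinuous 1 fun x => by
    simpa using norm_linearMapOfLE_le hp hpq hq x

theorem inclusionCLM_apply {p q : ℝ≥0∞} [Fact (1 ≤ p)] [Fact (1 ≤ q)] (hp : 0 < p.toReal)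
    (hpq : p ≤ q) (hq : q ≠ ∞) (x : lp (fun _ : ℕ => ℝ) p) (n : ℕ) :
    inclusionCLM hp hpq hq x n = x n := rfl

theorem strictlySingular_inclusionCLM {p q : ℝ≥0∞} [Fact (1 ≤ p)] [Fact (1 ≤ q)]
    (hp : 0 < p.toReal) (hpq : p < q) (hq : q ≠ ∞) :
    StrictlySingular (inclusionCLM hp hpq.le hq) := by
  intro M hM c hc
  have hd : 0 < q.toReal - p.toReal :=
    sub_pos.2 (ENNReal.toReal_strict_mono hq hpq)
  have hq0 : 0 < q.toReal := by linarith
  set r := q.toReal / (q.toReal - p.toReal) with hr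
  obtain ⟨x, hxM, hx2, hx⟩ := exists_mem_lt_norm hp hM (2 / c ^ r)
  have hcr : 0 < c ^ r := Real.rpow_pos_of_pos hc r
  have hx0 : 0 < ‖x‖ := lt_trans (by positivity) hx
  refine ⟨x, hxM, ?_⟩
  rw [← Real.rpow_lt_rpow_iff (norm_nonneg _) (by positivity) hq0]
  calc ‖inclusionCLM hp hpq.le hq x‖ ^ q.toReal
      ≤ 2 ^ (q.toReal - p.toReal) * ‖x‖ ^ p.toReal :=
        norm_linearMapOfLE_rpow_le hp hpq.le hq x hx2
    _ < (‖x‖ * c ^ r) ^ (q.toReal - p.toReal) * ‖x‖ ^ p.toReal := by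
        gcongr
        exact (div_lt_iff₀ hcr).1 hx
    _ = (c * ‖x‖) ^ q.toReal := by
        rw [Real.mul_rpow hx0.le hcr.le, ← Real.rpow_mul hc.le, hr, div_mul_cancel₀ _ hd.ne',
          Real.mul_rpow hc.le hx0.le, mul_right_comm, ← Real.rpow_add hx0, sub_add_cancel,
          mul_comm]

theorem not_isCompactOperator_inclusionCLM {p q : ℝ≥0∞} [Fact (1 ≤ p)] [Fact (1 ≤ q)]
    (hp : 0 < p.toReal) (hpq : p ≤ q) (hq : q ≠ ∞) :
    ¬ IsCompactOperator ⇑(inclusionCLM hp hpq hq) := by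
  intro h
  have hp0 : 0 < p := (ENNReal.toReal_pos_iff.1 hp).1
  let e (n : ℕ) : lp (fun _ : ℕ => ℝ) p := lp.single p n 1
  have hmem (n : ℕ) : inclusionCLM hp hpq hq (e n) ∈
      closure (inclusionCLM hp hpq hq '' Metric.closedBall 0 1) :=
    subset_closure ⟨e n, by simp [e, lp.norm_single hp0], rfl⟩
  obtain ⟨a, -, φ, hφ, hlim⟩ :=
    (h.isCompact_closure_image_closedBall
      (f := (inclusionCLM hp hpq hq).toLinearMap) 1).tendsto_subseq hmem
  obtain ⟨N, hN⟩ := Metric.cauchySeq_iff.1 hlim.cauchySeq 1 one_pos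
  have hlt := hN N le_rfl (N + 1) N.le_succ
  have hne : φ N ≠ φ (N + 1) := (hφ N.lt_succ_self).ne
  have hle := norm_apply_le_norm (hp0.trans_le hpq).ne'
    (inclusionCLM hp hpq hq (e (φ N)) - inclusionCLM hp hpq hq (e (φ (N + 1)))) (φ N)
  rw [coeFn_sub, Pi.sub_apply, inclusionCLM_apply, inclusionCLM_apply, lp.single_apply_self,
    lp.single_apply_ne _ _ _ hne, sub_zero, norm_one, ← dist_eq_norm] at hle
  exact hle.not_gt hlt

end lp

/-- For `1 ≤ p < q < ∞`, the formal inclusion map `ℓ_p → ℓ_q` (the bounded linear operator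
acting as the identity on coordinates) exists, and it is strictly singular but not compact. -/
theorem formal_inclusion_lp_lq_strictlySingular_not_compact
    (p q : ℝ) (hp : 1 ≤ p) (hpq : p < q)
    [Fact (1 ≤ ENNReal.ofReal p)] [Fact (1 ≤ ENNReal.ofReal q)] :
    ∃ R : lp (fun _ : ℕ => ℝ) (ENNReal.ofReal p) →L[ℝ] lp (fun _ : ℕ => ℝ) (ENNReal.ofReal q),
      (∀ (x : lp (fun _ : ℕ => ℝ) (ENNReal.ofReal p)) (n : ℕ), (R x) n = x n) ∧
      StrictlySingular R ∧ ¬ IsCompactOperator ⇑R := by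
  have hp0 : 0 < (ENNReal.ofReal p).toReal := by
    rw [ENNReal.toReal_ofReal (by linarith)]
    linarith
  have hlt : ENNReal.ofReal p < ENNReal.ofReal q :=
    (ENNReal.ofReal_lt_ofReal_iff (by linarith)).2 hpq
  exact ⟨lp.inclusionCLM hp0 hlt.le ENNReal.ofReal_ne_top,
    lp.inclusionCLM_apply hp0 hlt.le ENNReal.ofReal_ne_top,
    lp.strictlySingular_inclusionCLM hp0 hlt ENNReal.ofReal_ne_top,
    lp.not_isCompactOperator_inclusionCLM hp0 hlt.le ENNReal.ofReal_ne_top⟩
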